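/- arXiv:2512.05327 — 2 statements merged into one kernel-verified Lean document; each statement's English description precedes it below -/
import Mathlib

section
/- Let λ > Δ₁, let x, x⁺, g ∈ ℝ^d, and define F(y) := f₁(y) + h₁(x) + ⟨g − ∇f₁(x), y − x⟩ + (λ/2)‖y − x‖². If F(x⁺) ≤ F(x), then f(x⁺) ≤ f(x) − ((λ − Δ₁)/4)‖x⁺ − x‖² + ‖g − ∇f(x)‖² / (λ − Δ₁). -/
open scoped RealInnerProductSpace BigOperators

theorem descent_aux {d : ℕ} (h : EuclideanSpace ℝ (Fin d) → ℝ) (hd : Differentiable ℝ h)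
    (D : ℝ) (hED : ∀ x y, ‖gradient h x - gradient h y‖ ≤ D * ‖x - y‖)
    (x s : EuclideanSpace ℝ (Fin d)) :
    h (x + s) ≤ h x + ⟪gradient h x, s⟫ + D / 2 * ‖s‖ ^ 2 := by
  have hder : ∀ t : ℝ, HasDerivAt (fun t : ℝ => h (x + t • s)) ⟪gradient h (x + t • s), s⟫ t := by
    intro t
    have h1 := (hd (x + t • s)).hasGradientAt.hasFDerivAt
    have h2 : HasDerivAt (fun t : ℝ => x + t • s) s t := by
      simpa using ((hasDerivAt_id t).smul_const s).const_add x
    have h3 := h1.comp_hasDerivAt t h2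
    exact h3
  have hB : ∀ t : ℝ, HasDerivAt
      (fun t : ℝ => h x + t * ⟪gradient h x, s⟫ + D / 2 * ‖s‖ ^ 2 * t ^ 2)
      (⟪gradient h x, s⟫ + D * ‖s‖ ^ 2 * t) t := by
    intro t
    have := (((hasDerivAt_id t).mul_const ⟪gradient h x, s⟫).const_add (h x)).add
      ((hasDerivAt_pow 2 t).const_mul (D / 2 * ‖s‖ ^ 2))
    refine this.congr_deriv ?_
    simp
    ring
  have key := image_le_of_deriv_right_le_deriv_boundary (a := 0) (b := 1)
    (fun t _ => (hder t).continuousAt.continuousWithinAt)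
    (fun t _ => (hder t).hasDerivWithinAt) (by simp)
    (fun t _ => (hB t).continuousAt.continuousWithinAt)
    (fun t _ => (hB t).hasDerivWithinAt) (by
      intro t ht
      have h1 := real_inner_le_norm (gradient h (x + t • s) - gradient h x) s
      have h2 := hED (x + t • s) x
      rw [inner_sub_left] at h1
      rw [add_sub_cancel_left, norm_smul, Real.norm_of_nonneg ht.1] at h2
      have h3 := mul_le_mul_of_nonneg_right h2 (norm_nonneg s)
      nlinarith)
    (Set.right_mem_Icc.2 zero_le_one)
  simpa using key

/-- function value decrease for the I-CGM step. -/
theorem icgm_descent {d n : ℕ} (hn : 1 ≤ n)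
    (f_i : Fin n → EuclideanSpace ℝ (Fin d) → ℝ)
    (hdiff : ∀ i, Differentiable ℝ (f_i i))
    (f : EuclideanSpace ℝ (Fin d) → ℝ)
    (hf : f = fun x => (1 / (n : ℝ)) * ∑ i, f_i i x)
    (h₁ : EuclideanSpace ℝ (Fin d) → ℝ)
    (hh₁ : h₁ = fun x => f x - f_i ⟨0, hn⟩ x)
    (Δ₁ : ℝ) (hΔ₁ : 0 < Δ₁)
    (hED : ∀ x y, ‖gradient h₁ x - gradient h₁ y‖ ≤ Δ₁ * ‖x - y‖)
    (lam : ℝ) (hlam : Δ₁ < lam)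
    (x xp g : EuclideanSpace ℝ (Fin d))
    (F : EuclideanSpace ℝ (Fin d) → ℝ)
    (hF : F = fun y => f_i ⟨0, hn⟩ y + h₁ x
      + ⟪g - gradient (f_i ⟨0, hn⟩) x, y - x⟫ + (lam / 2) * ‖y - x‖ ^ 2)
    (hdec : F xp ≤ F x) :
    f xp ≤ f x - ((lam - Δ₁) / 4) * ‖xp - x‖ ^ 2
      + ‖g - gradient f x‖ ^ 2 / (lam - Δ₁) := by
  have hfd : Differentiable ℝ f := by
    rw [hf]
    exact (Differentiable.fun_sum (fun i _ => hdiff i)).const_mul _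
  have hhd : Differentiable ℝ h₁ := by
    rw [hh₁]
    exact hfd.sub (hdiff _)
  have hg : gradient h₁ x = gradient f x - gradient (f_i ⟨0, hn⟩) x := by
    have : fderiv ℝ h₁ x = fderiv ℝ f x - fderiv ℝ (f_i ⟨0, hn⟩) x := by
      rw [hh₁]
      exact fderiv_fun_sub (hfd x) (hdiff _ x)
    simp only [gradient, this, map_sub]
  have hdesc := descent_aux h₁ hhd Δ₁ hED x (xp - x)
  rw [add_sub_cancel, hg] at hdesc
  have e1 : h₁ xp = f xp - f_i ⟨0, hn⟩ xp := by rw [hh₁]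
  have e2 : h₁ x = f x - f_i ⟨0, hn⟩ x := by rw [hh₁]
  rw [hF] at hdec
  simp only [sub_self, inner_zero_right, norm_zero] at hdec
  have hcs := neg_le_of_abs_le (abs_real_inner_le_norm (g - gradient f x) (xp - x))
  simp only [inner_sub_left] at hdesc hdec hcs
  have hc : 0 < lam - Δ₁ := sub_pos.2 hlam
  have hy : ‖g - gradient f x‖ * ‖xp - x‖
      ≤ ‖g - gradient f x‖ ^ 2 / (lam - Δ₁) + (lam - Δ₁) / 4 * ‖xp - x‖ ^ 2 := by
    have : ‖g - gradient f x‖ ^ 2 / (lam - Δ₁) + (lam - Δ₁) / 4 * ‖xp - x‖ ^ 2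
        - ‖g - gradient f x‖ * ‖xp - x‖
        = (‖g - gradient f x‖ - (lam - Δ₁) / 2 * ‖xp - x‖) ^ 2 / (lam - Δ₁) := by
      field_simp
      ring
    have h0 : 0 ≤ (‖g - gradient f x‖ - (lam - Δ₁) / 2 * ‖xp - x‖) ^ 2 / (lam - Δ₁) := by
      positivity
    linarith
  linarith
end

section
/- Let (x_k)_{k≥0} be a sequence in ℝ^d such that for each k ≥ 0, x_{k+1} is a global minimizer over ℝ^d of y ↦ φ(x_k) + ⟨∇φ(x_k), y − x_k⟩ + (L_φ/2)‖y − x_k‖² + ψ(y), and assume F is bounded below. Let p ∈ (0,1]. Then ∑_{k=0}^∞ (1−p)^k p ‖∇F(x_{k+1})‖² ≤ (8 L_φ² p / (L_φ + λ_ψ)) · ( F(x₀) − ∑_{k=0}^∞ (1−p)^k p F(x_{k+1}) ), both series being convergent. (This is the expectation bound E[‖∇F(x_{K̂+1})‖²] ≤ (8L_φ²p/(L_φ+λ_ψ))(F(x₀) − E[F(x_{K̂+1})]) for K̂ geometrically distributed with parameter p.) -/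
open scoped RealInnerProductSpace BigOperators

/-- Descent lemma. -/
theorem cgm_descent {d : ℕ} (φ : EuclideanSpace ℝ (Fin d) → ℝ) (L : ℝ)
    (hd : Differentiable ℝ φ)
    (hlip : ∀ x y, ‖gradient φ x - gradient φ y‖ ≤ L * ‖x - y‖)
    (x v : EuclideanSpace ℝ (Fin d)) :
    φ (x + v) ≤ φ x + ⟪gradient φ x, v⟫ + (L / 2) * ‖v‖ ^ 2 := by
  let g : ℝ → ℝ := fun t => φ (x + t • v) - t * ⟪gradient φ x, v⟫ - (L / 2) * ‖v‖ ^ 2 * t ^ 2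
  have hg : ∀ t, HasDerivAt g (⟪gradient φ (x + t • v), v⟫ - ⟪gradient φ x, v⟫
      - L * ‖v‖ ^ 2 * t) t := by
    intro t
    have h1 : HasDerivAt (fun t : ℝ => x + t • v) v t := by
      simpa using ((hasDerivAt_id t).smul_const v).const_add x
    have h2 := ((hd (x + t • v)).hasGradientAt.hasFDerivAt).comp_hasDerivAt t h1
    have h3 := (hasDerivAt_id t).mul_const ⟪gradient φ x, v⟫
    have h4 := ((hasDerivAt_id t).pow 2).const_mul ((L / 2) * ‖v‖ ^ 2)
    have h5 := (h2.sub h3).sub h4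
    refine (h5.congr_deriv ?_)
    simp
    ring
  have hanti : AntitoneOn g (Set.Icc 0 1) := by
    apply antitoneOn_of_deriv_nonpos (convex_Icc 0 1)
    · exact fun t _ => (hg t).continuousAt.continuousWithinAt
    · exact fun t _ => (hg t).differentiableAt.differentiableWithinAt
    · intro t ht
      rw [interior_Icc] at ht
      rw [(hg t).deriv, ← inner_sub_left]
      have h1 := real_inner_le_norm (gradient φ (x + t • v) - gradient φ x) v
      have h2 := hlip (x + t • v) x
      rw [add_sub_cancel_left, norm_smul, Real.norm_eq_abs, abs_of_pos ht.1] at h2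
      nlinarith [mul_le_mul_of_nonneg_right h2 (norm_nonneg v)]
  have := hanti (by simp : (0:ℝ) ∈ Set.Icc (0:ℝ) 1) (by simp : (1:ℝ) ∈ Set.Icc (0:ℝ) 1) zero_le_one
  simp only [g, one_smul, zero_smul, add_zero] at this
  linarith

/-- First-order optimality. -/
theorem cgm_opt {d : ℕ} (ψ : EuclideanSpace ℝ (Fin d) → ℝ) (L c : ℝ)
    (hd : Differentiable ℝ ψ) (g x z : EuclideanSpace ℝ (Fin d))
    (hmin : ∀ y, c + ⟪g, z - x⟫ + (L / 2) * ‖z - x‖ ^ 2 + ψ z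
      ≤ c + ⟪g, y - x⟫ + (L / 2) * ‖y - x‖ ^ 2 + ψ y) :
    gradient ψ z = - g - L • (z - x) := by
  have key : ∀ v, ⟪g, v⟫ + L * ⟪z - x, v⟫ + ⟪gradient ψ z, v⟫ = 0 := by
    intro v
    let f : ℝ → ℝ := fun t => t * ⟪g, v⟫ + L * ⟪z - x, v⟫ * t + (L / 2) * ‖v‖ ^ 2 * t ^ 2
      + ψ (z + t • v)
    have hf : HasDerivAt f (⟪g, v⟫ + L * ⟪z - x, v⟫ + ⟪gradient ψ z, v⟫) 0 := by
      have h1 : HasDerivAt (fun t : ℝ => z + t • v) v 0 := by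
        simpa using ((hasDerivAt_id (0:ℝ)).smul_const v).const_add z
      have h2 := ((hd (z + (0:ℝ) • v)).hasGradientAt.hasFDerivAt).comp_hasDerivAt 0 h1
      have h3 := (hasDerivAt_id (0:ℝ)).mul_const ⟪g, v⟫
      have h3' := (hasDerivAt_id (0:ℝ)).const_mul (L * ⟪z - x, v⟫)
      have h4 := ((hasDerivAt_id (0:ℝ)).pow 2).const_mul ((L / 2) * ‖v‖ ^ 2)
      refine ((((h3.add h3').add h4).add h2).congr_deriv ?_)
      simp
    have hm : IsLocalMin f 0 := by
      refine Filter.Eventually.of_forall fun t => ?_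
      have h := hmin (z + t • v)
      rw [show z + t • v - x = (z - x) + t • v by abel, inner_add_right, norm_add_sq_real,
        real_inner_smul_right, real_inner_smul_right, norm_smul, mul_pow, Real.norm_eq_abs,
        sq_abs] at h
      simp only [f]
      simp
      linarith
    exact hm.hasDerivAt_eq_zero hf
  refine ext_inner_right ℝ fun v => ?_
  rw [inner_sub_left, inner_neg_left, real_inner_smul_left]
  linarith [key v]

/-- Quadratic growth of the model at the minimizer. -/
theorem cgm_growth {d : ℕ} (ψ : EuclideanSpace ℝ (Fin d) → ℝ) (L lam c : ℝ)
    (hψsc : ConvexOn ℝ Set.univ (fun y => ψ y - (lam / 2) * ‖y‖ ^ 2))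
    (g x z : EuclideanSpace ℝ (Fin d))
    (hmin : ∀ y, c + ⟪g, z - x⟫ + (L / 2) * ‖z - x‖ ^ 2 + ψ z
      ≤ c + ⟪g, y - x⟫ + (L / 2) * ‖y - x‖ ^ 2 + ψ y) :
    ⟪g, z - x⟫ + (L / 2) * ‖z - x‖ ^ 2 + ψ z + (L + lam) / 2 * ‖z - x‖ ^ 2 ≤ ψ x := by
  have key : ∀ t ∈ Set.Ioo (0:ℝ) 1, ⟪g, z - x⟫ + (L / 2) * ‖z - x‖ ^ 2 + ψ z
      + (1 - t) * ((L + lam) / 2 * ‖z - x‖ ^ 2) ≤ ψ x := by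
    intro t ht
    have h := hmin (x + (1 - t) • (z - x))
    have hc := hψsc.2 (Set.mem_univ x) (Set.mem_univ z) ht.1.le (sub_nonneg.2 ht.2.le) (by ring)
    rw [show t • x + (1 - t) • z = x + (1 - t) • (z - x) by module] at hc
    have hz : ‖z‖ ^ 2 = ‖x‖ ^ 2 + 2 * ⟪x, z - x⟫ + ‖z - x‖ ^ 2 := by
      rw [← norm_add_sq_real, add_sub_cancel]
    have e := norm_add_sq_real x ((1 - t) • (z - x))
    rw [real_inner_smul_right, norm_smul, mul_pow, Real.norm_eq_abs, sq_abs] at e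
    simp only [smul_eq_mul, e, hz] at hc
    rw [add_sub_cancel_left, real_inner_smul_right, norm_smul, mul_pow, Real.norm_eq_abs,
      sq_abs] at h
    refine le_of_mul_le_mul_left ?_ ht.1
    linear_combination h + hc
  have hlim : Filter.Tendsto (fun t : ℝ => ⟪g, z - x⟫ + (L / 2) * ‖z - x‖ ^ 2 + ψ z
      + (1 - t) * ((L + lam) / 2 * ‖z - x‖ ^ 2)) (nhdsWithin 0 (Set.Ioi 0))
      (nhds (⟪g, z - x⟫ + (L / 2) * ‖z - x‖ ^ 2 + ψ z
      + (1 - 0) * ((L + lam) / 2 * ‖z - x‖ ^ 2))) := by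
    apply Filter.Tendsto.mono_left _ nhdsWithin_le_nhds
    apply Continuous.tendsto (f := fun t : ℝ => ⟪g, z - x⟫ + (L / 2) * ‖z - x‖ ^ 2 + ψ z
      + (1 - t) * ((L + lam) / 2 * ‖z - x‖ ^ 2))
    fun_prop
  have := le_of_tendsto hlim (Filter.mem_of_superset (Ioo_mem_nhdsGT one_pos) key)
  linarith



/-- expectation bound for the composite gradient method with a
geometrically distributed number of steps. -/
theorem cgm_geometric_bound {d : ℕ}
    (φ ψ : EuclideanSpace ℝ (Fin d) → ℝ)
    (Lφ lamψ : ℝ) (hLφ : 0 < Lφ) (hlamψ : 0 ≤ lamψ)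
    (hφdiff : Differentiable ℝ φ)
    (hφlip : ∀ x y, ‖gradient φ x - gradient φ y‖ ≤ Lφ * ‖x - y‖)
    (hψdiff : Differentiable ℝ ψ)
    (hψsc : ConvexOn ℝ Set.univ (fun y => ψ y - (lamψ / 2) * ‖y‖ ^ 2))
    (F : EuclideanSpace ℝ (Fin d) → ℝ) (hFdef : F = fun y => φ y + ψ y)
    (hFbdd : BddBelow (Set.range F))
    (x : ℕ → EuclideanSpace ℝ (Fin d))
    (hmin : ∀ k : ℕ, ∀ y,
      φ (x k) + ⟪gradient φ (x k), x (k + 1) - x k⟫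
        + (Lφ / 2) * ‖x (k + 1) - x k‖ ^ 2 + ψ (x (k + 1))
      ≤ φ (x k) + ⟪gradient φ (x k), y - x k⟫
        + (Lφ / 2) * ‖y - x k‖ ^ 2 + ψ y)
    (p : ℝ) (hp : p ∈ Set.Ioc (0 : ℝ) 1) :
    Summable (fun k : ℕ => (1 - p) ^ k * p * ‖gradient F (x (k + 1))‖ ^ 2)
    ∧ Summable (fun k : ℕ => (1 - p) ^ k * p * F (x (k + 1)))
    ∧ ∑' k : ℕ, (1 - p) ^ k * p * ‖gradient F (x (k + 1))‖ ^ 2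
      ≤ (8 * Lφ ^ 2 * p / (Lφ + lamψ))
        * (F (x 0) - ∑' k : ℕ, (1 - p) ^ k * p * F (x (k + 1))) := by
  obtain ⟨hp0, hp1⟩ := hp
  have hLl : 0 < Lφ + lamψ := by linarith
  have hdesc : ∀ k, (Lφ + lamψ) / 2 * ‖x (k + 1) - x k‖ ^ 2 ≤ F (x k) - F (x (k + 1)) := by
    intro k
    have h1 := cgm_descent φ Lφ hφdiff hφlip (x k) (x (k + 1) - x k)
    have h2 := cgm_growth ψ Lφ lamψ _ hψsc _ _ _ (hmin k)
    rw [add_sub_cancel] at h1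
    simp only [hFdef]
    linarith
  have hgrad : ∀ k, ‖gradient F (x (k + 1))‖ ≤ 2 * Lφ * ‖x (k + 1) - x k‖ := by
    intro k
    have h1 := cgm_opt ψ Lφ _ hψdiff _ _ _ (hmin k)
    have h2 : gradient F (x (k + 1)) = gradient φ (x (k + 1)) + gradient ψ (x (k + 1)) := by
      rw [hFdef]
      apply HasGradientAt.gradient
      rw [hasGradientAt_iff_hasFDerivAt, map_add]
      exact (hφdiff _).hasGradientAt.hasFDerivAt.add (hψdiff _).hasGradientAt.hasFDerivAt
    have h3 : gradient F (x (k + 1)) = (gradient φ (x (k + 1)) - gradient φ (x k))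
        - Lφ • (x (k + 1) - x k) := by
      rw [h2, h1]; abel
    rw [h3]
    refine (norm_sub_le _ _).trans ?_
    rw [norm_smul, Real.norm_eq_abs, abs_of_pos hLφ]
    linarith [hφlip (x (k + 1)) (x k)]
  have hstep : ∀ k, ‖gradient F (x (k + 1))‖ ^ 2
      ≤ 8 * Lφ ^ 2 / (Lφ + lamψ) * (F (x k) - F (x (k + 1))) := by
    intro k
    have h1 : ‖gradient F (x (k + 1))‖ ^ 2 ≤ (2 * Lφ * ‖x (k + 1) - x k‖) ^ 2 :=
      pow_le_pow_left₀ (norm_nonneg _) (hgrad k) 2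
    have h2 := mul_le_mul_of_nonneg_left (hdesc k)
      (by positivity : 0 ≤ 8 * Lφ ^ 2 / (Lφ + lamψ))
    have h3 : 8 * Lφ ^ 2 / (Lφ + lamψ) * ((Lφ + lamψ) / 2 * ‖x (k + 1) - x k‖ ^ 2)
        = (2 * Lφ * ‖x (k + 1) - x k‖) ^ 2 := by
      field_simp
      ring
    linarith
  have hanti : Antitone (fun k => F (x k)) := by
    refine antitone_nat_of_succ_le fun k => ?_
    have : 0 ≤ (Lφ + lamψ) / 2 * ‖x (k + 1) - x k‖ ^ 2 := by positivity
    linarith [hdesc k]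
  obtain ⟨m, hm⟩ := hFbdd
  have hm' : ∀ k, m ≤ F (x k) := fun k => hm ⟨x k, rfl⟩
  have hq0 : 0 ≤ 1 - p := by linarith
  have hgeo : Summable (fun k : ℕ => (1 - p) ^ k) :=
    summable_geometric_of_lt_one hq0 (by linarith)
  have hS0 : Summable (fun k : ℕ => (1 - p) ^ k * p * F (x k)) := by
    refine Summable.of_norm_bounded (hgeo.mul_right (p * (|m| + |F (x 0)|))) fun k => ?_
    rw [mul_assoc, norm_mul, norm_mul, Real.norm_of_nonneg (pow_nonneg hq0 k),
      Real.norm_of_nonneg hp0.le, Real.norm_eq_abs]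
    refine mul_le_mul_of_nonneg_left (mul_le_mul_of_nonneg_left ?_ hp0.le) (pow_nonneg hq0 k)
    have h0 : F (x k) ≤ F (x 0) := hanti (Nat.zero_le k)
    rw [abs_le]
    constructor
    · linarith [hm' k, neg_abs_le m, abs_nonneg (F (x 0))]
    · linarith [le_abs_self (F (x 0)), abs_nonneg m]
  have hS1 : Summable (fun k : ℕ => (1 - p) ^ k * p * F (x (k + 1))) := by
    refine Summable.of_norm_bounded (hgeo.mul_right (p * (|m| + |F (x 0)|))) fun k => ?_
    rw [mul_assoc, norm_mul, norm_mul, Real.norm_of_nonneg (pow_nonneg hq0 k),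
      Real.norm_of_nonneg hp0.le, Real.norm_eq_abs]
    refine mul_le_mul_of_nonneg_left (mul_le_mul_of_nonneg_left ?_ hp0.le) (pow_nonneg hq0 k)
    have h0 : F (x (k + 1)) ≤ F (x 0) := hanti (Nat.zero_le (k + 1))
    rw [abs_le]
    constructor
    · linarith [hm' (k + 1), neg_abs_le m, abs_nonneg (F (x 0))]
    · linarith [le_abs_self (F (x 0)), abs_nonneg m]
  have hT := hS0.tsum_eq_zero_add
  have hT2 : ∑' k : ℕ, (1 - p) ^ (k + 1) * p * F (x (k + 1))
      = (1 - p) * ∑' k : ℕ, (1 - p) ^ k * p * F (x (k + 1)) := by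
    rw [← tsum_mul_left]
    exact tsum_congr fun k => by ring
  rw [hT2, pow_zero, one_mul] at hT
  have hR : Summable (fun k : ℕ => 8 * Lφ ^ 2 / (Lφ + lamψ) *
      ((1 - p) ^ k * p * F (x k) - (1 - p) ^ k * p * F (x (k + 1)))) :=
    (hS0.sub hS1).mul_left _
  have hle : ∀ k : ℕ, (1 - p) ^ k * p * ‖gradient F (x (k + 1))‖ ^ 2 ≤
      8 * Lφ ^ 2 / (Lφ + lamψ) *
      ((1 - p) ^ k * p * F (x k) - (1 - p) ^ k * p * F (x (k + 1))) := by
    intro k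
    have := mul_le_mul_of_nonneg_left (hstep k) (mul_nonneg (pow_nonneg hq0 k) hp0.le)
    linarith
  have hG : Summable (fun k : ℕ => (1 - p) ^ k * p * ‖gradient F (x (k + 1))‖ ^ 2) :=
    Summable.of_nonneg_of_le (fun k => mul_nonneg (mul_nonneg (pow_nonneg hq0 k) hp0.le)
      (sq_nonneg _)) hle hR
  refine ⟨hG, hS1, (hG.tsum_le_tsum hle hR).trans (le_of_eq ?_)⟩
  rw [tsum_mul_left, hS0.tsum_sub hS1, hT]
  ring
end
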